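/- For each proper two-sided ideal a of the algebra S_n, the set Min(a) of prime two-sided ideals of S_n that are minimal among the primes containing a is finite and non-empty. -/

import Mathlib

set_option synthInstance.maxHeartbeats 1000000
set_option maxHeartbeats 1000000

open MvPolynomial

noncomputable section

/-- The polynomial algebra `P_n = K[x_1, …, x_n]`. -/
abbrev PolyAlg (K : Type u) [Field K] (n : ℕ) := MvPolynomial (Fin n) K

/-- `X_i` : multiplication by the variable `x_i`, as a `K`-linear endomorphism of `P_n`. -/
def Xop (K : Type u) [Field K] (n : ℕ) (i : Fin n) : Module.End K (PolyAlg K n) :=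
  LinearMap.mulLeft K (X i)

/-- `Y_i` : the left inverse of `X_i`, sending a monomial `x^α` to `x^{α - e_i}` if `α i ≥ 1`
and to `0` otherwise. -/
def Yop (K : Type u) [Field K] (n : ℕ) (i : Fin n) : Module.End K (PolyAlg K n) :=
  (basisMonomials (Fin n) K).constr K fun α =>
    if α i = 0 then 0 else monomial (α - Finsupp.single i 1) (1 : K)

/-- The algebra `S_n` of one-sided inverses of `P_n` : the subalgebra of `End_K(P_n)`
generated by `X_1, …, X_n, Y_1, …, Y_n`. -/
def SnAlg (K : Type u) [Field K] (n : ℕ) : Subalgebra K (Module.End K (PolyAlg K n)) :=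
  Algebra.adjoin K (Set.range (Xop K n) ∪ Set.range (Yop K n))

/-- `x_i` as an element of `S_n`. -/
def xS (K : Type u) [Field K] (n : ℕ) (i : Fin n) : SnAlg K n :=
  ⟨Xop K n i, Algebra.subset_adjoin (Set.mem_union_left _ ⟨i, rfl⟩)⟩

/-- `y_i` as an element of `S_n`. -/
def yS (K : Type u) [Field K] (n : ℕ) (i : Fin n) : SnAlg K n :=
  ⟨Yop K n i, Algebra.subset_adjoin (Set.mem_union_right _ ⟨i, rfl⟩)⟩

/-- The product `I*J` of two two-sided ideals: the two-sided ideal generated by all products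
`a * b` with `a ∈ I`, `b ∈ J`. -/
def tsiMul {R : Type*} [Ring R] (I J : TwoSidedIdeal R) : TwoSidedIdeal R :=
  TwoSidedIdeal.span {x | ∃ a ∈ I, ∃ b ∈ J, x = a * b}

/-- A two-sided ideal `P` of a ring is prime if it is proper and for all two-sided ideals
`I`, `J`, `I*J ⊆ P` implies `I ⊆ P` or `J ⊆ P`. -/
def tsiPrime {R : Type*} [Ring R] (P : TwoSidedIdeal R) : Prop :=
  P ≠ ⊤ ∧ ∀ I J : TwoSidedIdeal R, tsiMul I J ≤ P → I ≤ P ∨ J ≤ P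

/-- The set of prime two-sided ideals that are minimal among the primes containing `a`. -/
def minPrimesOver {R : Type*} [Ring R] (a : TwoSidedIdeal R) : Set (TwoSidedIdeal R) :=
  {P | tsiPrime P ∧ a ≤ P ∧ ∀ Q, tsiPrime Q → a ≤ Q → Q ≤ P → Q = P}

/-- The ascending chain condition passes from a partial order to monotone sequences in it. -/
theorem wellFoundedGT_orderHom_nat (α : Type*) [PartialOrder α] [WellFoundedGT α] :
    WellFoundedGT (ℕ →o α) := by
  rw [wellFoundedGT_iff_monotone_chain_condition]
  intro f
  obtain ⟨N, hN⟩ := WellFoundedGT.monotone_chain_condition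
    (⟨fun k => f k k, fun i j h => (f.monotone h i).trans ((f j).monotone h)⟩ : ℕ →o α)
  have h1 : ∀ m, ∃ M, ∀ k, M ≤ k → f M m = f k m := fun m =>
    WellFoundedGT.monotone_chain_condition
      (⟨fun k => f k m, fun i j h => f.monotone h m⟩ : ℕ →o α)
  choose M hM using h1
  refine ⟨N + ∑ m ∈ Finset.range N, M m, fun k hk => ?_⟩
  ext m
  rcases lt_or_ge m N with hm | hm
  · have hMm : M m ≤ ∑ m ∈ Finset.range N, M m :=
      Finset.single_le_sum (f := M) (fun _ _ => Nat.zero_le _) (Finset.mem_range.2 hm)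
    rw [← hM m _ (by omega), ← hM m k (by omega)]
  · have key : ∀ j, N ≤ j → f j m = f N N := by
      intro j hj
      refine le_antisymm ?_ (le_trans (f.monotone hj N) ((f j).monotone hm))
      have h2 : f N N = f (max j m) (max j m) := hN _ (hj.trans (le_max_left _ _))
      rw [h2]
      exact (f.monotone (le_max_left j m) m).trans
        ((f (max j m)).monotone (le_max_right j m))
    rw [key _ (by omega), key k (by omega)]

section Primes

variable {R : Type*} [Ring R]

theorem tsiMul_le_iff {I J P : TwoSidedIdeal R} :
    tsiMul I J ≤ P ↔ ∀ a ∈ I, ∀ b ∈ J, a * b ∈ P := by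
  rw [tsiMul, TwoSidedIdeal.span_le]
  constructor
  · intro h a ha b hb
    exact h ⟨a, ha, b, hb, rfl⟩
  · rintro h _ ⟨a, ha, b, hb, rfl⟩
    exact h a ha b hb

theorem tsiPrime_of_isCoatom {M : TwoSidedIdeal R} (hM : IsCoatom M) : tsiPrime M := by
  refine ⟨hM.1, fun I J h => ?_⟩
  rw [tsiMul_le_iff] at h
  by_contra! hIJ
  have hI : (1 : R) ∈ M ⊔ I := by
    rw [hM.2 (M ⊔ I) (left_lt_sup.2 hIJ.1)]; trivial
  have hJ : (1 : R) ∈ M ⊔ J := by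
    rw [hM.2 (M ⊔ J) (left_lt_sup.2 hIJ.2)]; trivial
  obtain ⟨m, hm, i, hi, h1⟩ := TwoSidedIdeal.mem_sup.1 hI
  obtain ⟨m', hm', j, hj, h2⟩ := TwoSidedIdeal.mem_sup.1 hJ
  apply hM.1
  rw [← TwoSidedIdeal.one_mem_iff]
  have h3 : (1 : R) = m * (m' + j) + (i * m' + i * j) := by
    rw [← mul_add, ← add_mul, h1, h2, one_mul]
  rw [h3]
  exact M.add_mem (M.mul_mem_right _ _ hm)
    (M.add_mem (M.mul_mem_left _ _ hm') (h i hi j hj))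

/-- Under the ascending chain condition, finitely many primes over `a` lie below all primes
over `a`. -/
theorem exists_finite_primes_le [WellFoundedGT (TwoSidedIdeal R)] (a : TwoSidedIdeal R) :
    ∃ L : Set (TwoSidedIdeal R), L.Finite ∧ (∀ P ∈ L, tsiPrime P ∧ a ≤ P) ∧
      ∀ Q, tsiPrime Q → a ≤ Q → ∃ P ∈ L, P ≤ Q := by
  induction a using WellFoundedGT.induction with
  | ind a ih =>
    by_cases ht : a = ⊤
    · exact ⟨∅, Set.finite_empty, by simp, fun Q hQ h => (hQ.1 (top_le_iff.1 (ht ▸ h))).elim⟩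
    by_cases hp : tsiPrime a
    · exact ⟨{a}, Set.finite_singleton a, by simp [hp], fun Q _ h => ⟨a, rfl, h⟩⟩
    obtain ⟨I, J, hIJ, hI, hJ⟩ : ∃ I J, tsiMul I J ≤ a ∧ ¬ I ≤ a ∧ ¬ J ≤ a := by
      by_contra! h
      exact hp ⟨ht, fun I J hIJ => or_iff_not_imp_left.2 (h I J hIJ)⟩
    obtain ⟨L₁, hf₁, hp₁, hm₁⟩ := ih (a ⊔ I) (left_lt_sup.2 hI)
    obtain ⟨L₂, hf₂, hp₂, hm₂⟩ := ih (a ⊔ J) (left_lt_sup.2 hJ)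
    refine ⟨L₁ ∪ L₂, hf₁.union hf₂, ?_, fun Q hQ haQ => ?_⟩
    · rintro P (h | h)
      · exact ⟨(hp₁ P h).1, le_sup_left.trans (hp₁ P h).2⟩
      · exact ⟨(hp₂ P h).1, le_sup_left.trans (hp₂ P h).2⟩
    · rcases hQ.2 I J (hIJ.trans haQ) with h | h
      · obtain ⟨P, hP, hPQ⟩ := hm₁ Q hQ (sup_le haQ h)
        exact ⟨P, Or.inl hP, hPQ⟩
      · obtain ⟨P, hP, hPQ⟩ := hm₂ Q hQ (sup_le haQ h)
        exact ⟨P, Or.inr hP, hPQ⟩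

theorem minPrimesOver_finite_nonempty [WellFoundedGT (TwoSidedIdeal R)] {a : TwoSidedIdeal R}
    (ha : a ≠ ⊤) : (minPrimesOver a).Finite ∧ (minPrimesOver a).Nonempty := by
  obtain ⟨L, hf, hp, hm⟩ := exists_finite_primes_le a
  constructor
  · refine hf.subset fun P hP => ?_
    obtain ⟨Q, hQ, hQP⟩ := hm P hP.1 hP.2.1
    rwa [← hP.2.2 Q (hp Q hQ).1 (hp Q hQ).2 hQP]
  · obtain ⟨M, hM, haM⟩ := (eq_top_or_exists_le_coatom a).resolve_left ha
    obtain ⟨P₀, hP₀, -⟩ := hm M (tsiPrime_of_isCoatom hM) haM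
    obtain ⟨P, hP⟩ := hf.exists_minimal ⟨P₀, hP₀⟩
    refine ⟨P, (hp P hP.prop).1, (hp P hP.prop).2, fun Q hQ haQ hQP => ?_⟩
    obtain ⟨P', hP', hPQ⟩ := hm Q hQ haQ
    exact le_antisymm hQP ((hP.le_of_le hP' (hPQ.trans hQP)).trans hPQ)

end Primes

section HilbertBasis

open Polynomial

variable {R : Type*} [Ring R]

/-- The two-sided ideal of the coefficients at `X ^ m` of the elements of `I` of degree at
most `m`. -/
def TwoSidedIdeal.leadingCoeffIdeal (I : TwoSidedIdeal R[X]) (m : ℕ) : TwoSidedIdeal R :=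
  .mk' {r | ∃ p ∈ I, p.natDegree ≤ m ∧ p.coeff m = r}
    ⟨0, I.zero_mem, by simp⟩
    (by
      rintro _ _ ⟨p, hp, hpm, rfl⟩ ⟨q, hq, hqm, rfl⟩
      exact ⟨p + q, I.add_mem hp hq, natDegree_add_le_of_degree_le hpm hqm, by simp⟩)
    (by
      rintro _ ⟨p, hp, hpm, rfl⟩
      exact ⟨-p, I.neg_mem hp, by simpa, by simp⟩)
    (by
      rintro r _ ⟨p, hp, hpm, rfl⟩
      exact ⟨C r * p, I.mul_mem_left _ _ hp, (natDegree_C_mul_le _ _).trans hpm, by simp⟩)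
    (by
      rintro _ r ⟨p, hp, hpm, rfl⟩
      exact ⟨p * C r, I.mul_mem_right _ _ hp, (natDegree_mul_C_le _ _).trans hpm, by simp⟩)

theorem TwoSidedIdeal.mem_leadingCoeffIdeal {I : TwoSidedIdeal R[X]} {m : ℕ} {r : R} :
    r ∈ I.leadingCoeffIdeal m ↔ ∃ p ∈ I, p.natDegree ≤ m ∧ p.coeff m = r :=
  TwoSidedIdeal.mem_mk' ..

theorem TwoSidedIdeal.leadingCoeffIdeal_monotone (I : TwoSidedIdeal R[X]) :
    Monotone I.leadingCoeffIdeal := by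
  refine monotone_nat_of_le_succ fun m r hr => ?_
  obtain ⟨p, hp, hpm, rfl⟩ := mem_leadingCoeffIdeal.1 hr
  exact mem_leadingCoeffIdeal.2
    ⟨p * Polynomial.X, I.mul_mem_right _ _ hp, natDegree_mul_le_of_le hpm natDegree_X_le, by simp⟩

/-- The ideals of leading coefficients determine a two-sided ideal among those above it. -/
theorem TwoSidedIdeal.le_of_leadingCoeffIdeal_le {I J : TwoSidedIdeal R[X]} (hIJ : I ≤ J)
    (h : ∀ m, J.leadingCoeffIdeal m ≤ I.leadingCoeffIdeal m) : J ≤ I := by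
  have key : ∀ m, ∀ p ∈ J, p.natDegree < m → p ∈ I := by
    intro m
    induction m with
    | zero => intro p _ h; omega
    | succ m ih =>
      intro p hp hpm
      obtain ⟨q, hq, hqm, hc⟩ := mem_leadingCoeffIdeal.1
        (h m (mem_leadingCoeffIdeal.2 ⟨p, hp, by omega, rfl⟩))
      have hpq : p - q ∈ I := by
        by_cases h0 : p - q = 0
        · rw [h0]; exact I.zero_mem
        have hd : (p - q).natDegree ≤ m := (natDegree_sub_le_of_le (Nat.lt_succ_iff.1 hpm) hqm).trans_eq (max_self m)
        rcases hd.lt_or_eq with hd | hd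
        · exact ih _ (J.sub_mem hp (hIJ hq)) hd
        · refine (h0 (leadingCoeff_eq_zero.1 ?_)).elim
          rw [leadingCoeff, hd, Polynomial.coeff_sub, hc, sub_self]
      simpa using I.add_mem hpq hq
  exact fun p hp => key _ p hp (Nat.lt_succ_self _)

/-- Hilbert's basis theorem for two-sided ideals. -/
theorem wellFoundedGT_twoSidedIdeal_polynomial [WellFoundedGT (TwoSidedIdeal R)] :
    WellFoundedGT (TwoSidedIdeal R[X]) := by
  have := wellFoundedGT_orderHom_nat (TwoSidedIdeal R)
  let L : TwoSidedIdeal R[X] → (ℕ →o TwoSidedIdeal R) :=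
    fun I => ⟨I.leadingCoeffIdeal, I.leadingCoeffIdeal_monotone⟩
  have hL : Monotone L := by
    intro I J h m r hr
    obtain ⟨p, hp, hpm⟩ := TwoSidedIdeal.mem_leadingCoeffIdeal.1 hr
    exact TwoSidedIdeal.mem_leadingCoeffIdeal.2 ⟨p, h hp, hpm⟩
  refine StrictMono.wellFoundedGT (f := L) fun I J h => ?_
  refine lt_of_le_not_ge (hL h.le) fun h' => h.not_ge ?_
  exact TwoSidedIdeal.le_of_leadingCoeffIdeal_le h.le h'

end HilbertBasis

section OneSidedInverse

variable {R A : Type*} [Ring R] [Ring A] {f : R →+* A} {x y : A}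

theorem pow_mul_pow_of_mul_eq_one (hyx : y * x = 1) (j : ℕ) : y ^ j * x ^ j = 1 := by
  induction j with
  | zero => simp
  | succ j ih => rw [pow_succ, pow_succ', mul_assoc, ← mul_assoc y, hyx, one_mul, ih]

theorem one_sub_pow_mul_pow (x y : A) (N : ℕ) :
    1 - x ^ N * y ^ N = ∑ i ∈ Finset.range N, x ^ i * (1 - x * y) * y ^ i := by
  induction N with
  | zero => simp
  | succ N ih => rw [Finset.sum_range_succ, ← ih, pow_succ, pow_succ']; noncomm_ring

/-- A ring generated by the image of `f` together with `x` and `y`, where `y * x = 1` and `x`, `y`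
commute with the image of `f`, is additively spanned by the elements `f r * x ^ i * y ^ j`. -/
theorem span_of_oneSidedInverse (hyx : y * x = 1) (hx : ∀ r, Commute (f r) x)
    (hy : ∀ r, Commute (f r) y)
    (hgen : ∀ S : Subring A, (∀ r, f r ∈ S) → x ∈ S → y ∈ S → S = ⊤)
    {p : A → Prop} (h0 : p 0) (hadd : ∀ a b, p a → p b → p (a + b))
    (hmon : ∀ r i j, p (f r * x ^ i * y ^ j)) (a : A) : p a := by
  let M : AddSubmonoid A := AddSubmonoid.closure {a | ∃ r i j, a = f r * x ^ i * y ^ j}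
  have hM : ∀ r i j, f r * x ^ i * y ^ j ∈ M := fun r i j =>
    AddSubmonoid.subset_closure ⟨r, i, j, rfl⟩
  have hind : ∀ b, (∀ r i j, b * (f r * x ^ i * y ^ j) ∈ M) → ∀ m ∈ M, b * m ∈ M := by
    intro b hb m hm
    induction hm using AddSubmonoid.closure_induction with
    | mem m hm => obtain ⟨r, i, j, rfl⟩ := hm; exact hb r i j
    | zero => simp
    | add m m' _ _ h h' => rw [mul_add]; exact M.add_mem h h'
  have hf : ∀ r, ∀ m ∈ M, f r * m ∈ M := fun r => hind _ fun r' i j => by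
    rw [← mul_assoc, ← mul_assoc, ← map_mul]; exact hM _ i j
  let S : Subring A :=
    { carrier := {b | ∀ m ∈ M, b * m ∈ M}
      mul_mem' := fun {b c} hb hc m hm => by rw [mul_assoc]; exact hb _ (hc m hm)
      one_mem' := fun m hm => by rwa [one_mul]
      add_mem' := fun {b c} hb hc m hm => by rw [add_mul]; exact M.add_mem (hb m hm) (hc m hm)
      zero_mem' := fun m _ => by rw [zero_mul]; exact M.zero_mem
      neg_mem' := fun {b} hb m hm => by
        have h := hf (-1) _ (hb m hm)
        rwa [map_neg, map_one, neg_one_mul, ← neg_mul] at h }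
  have hS : S = ⊤ := by
    refine hgen S hf (hind _ fun r i j => ?_) (hind _ fun r i j => ?_)
    · rw [← mul_assoc, ← mul_assoc, ← (hx r).eq, mul_assoc (f r), ← pow_succ']
      exact hM r (i + 1) j
    · rw [← mul_assoc, ← mul_assoc, ← (hy r).eq, mul_assoc (f r)]
      cases i with
      | zero => rw [pow_zero, mul_one, mul_assoc, ← pow_succ']; simpa using hM r 0 (j + 1)
      | succ i => rw [pow_succ', ← mul_assoc y, hyx, one_mul]; exact hM r i j
  have ha : a ∈ S := hS ▸ Subring.mem_top a
  have haM : a ∈ M := by simpa using ha 1 (by simpa using hM 1 0 0)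
  induction haM using AddSubmonoid.closure_induction with
  | mem m hm => obtain ⟨r, i, j, rfl⟩ := hm; exact hmon r i j
  | zero => exact h0
  | add m m' _ _ h h' => exact hadd _ _ (h (hS ▸ Subring.mem_top m)) (h' (hS ▸ Subring.mem_top m'))

theorem exists_corner_eq (hyx : y * x = 1) (hx : ∀ r, Commute (f r) x)
    (hy : ∀ r, Commute (f r) y)
    (hgen : ∀ S : Subring A, (∀ r, f r ∈ S) → x ∈ S → y ∈ S → S = ⊤) (a : A) :
    ∃ r, (1 - x * y) * a * (1 - x * y) = f r * (1 - x * y) := by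
  have hex : (1 - x * y) * x = 0 := by rw [sub_mul, mul_assoc, hyx]; simp
  have hye : y * (1 - x * y) = 0 := by rw [mul_sub, ← mul_assoc, hyx]; simp
  induction a using span_of_oneSidedInverse hyx hx hy hgen with
  | h0 => exact ⟨0, by simp⟩
  | hadd a b ha hb =>
    obtain ⟨r, hr⟩ := ha
    obtain ⟨s, hs⟩ := hb
    exact ⟨r + s, by rw [mul_add, add_mul, hr, hs, map_add, add_mul]⟩
  | hmon r i j =>
    have hc : Commute (f r) (1 - x * y) :=
      (Commute.one_right _).sub_right ((hx r).mul_right (hy r))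
    have key : (1 - x * y) * (f r * x ^ i * y ^ j) * (1 - x * y) =
        f r * (((1 - x * y) * x ^ i) * (y ^ j * (1 - x * y))) := by
      rw [← mul_assoc, ← mul_assoc, ← hc.eq]
      simp only [mul_assoc]
    rw [key]
    cases i with
    | succ i => exact ⟨0, by rw [pow_succ', ← mul_assoc _ x, hex]; simp⟩
    | zero =>
      cases j with
      | succ j => exact ⟨0, by rw [pow_succ, mul_assoc _ y, hye]; simp⟩
      | zero => exact ⟨r, by simp [mul_sub, ← mul_assoc, hex]⟩

open Polynomial in
theorem exists_mul_pow_eq_eval₂ (hyx : y * x = 1) (hx : ∀ r, Commute (f r) x)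
    (hy : ∀ r, Commute (f r) y)
    (hgen : ∀ S : Subring A, (∀ r, f r ∈ S) → x ∈ S → y ∈ S → S = ⊤) (a : A) :
    ∃ k₀, ∀ k, k₀ ≤ k → ∃ p : R[X], a * x ^ k = eval₂RingHom' f x hx p := by
  induction a using span_of_oneSidedInverse hyx hx hy hgen with
  | h0 => exact ⟨0, fun k _ => ⟨0, by simp⟩⟩
  | hadd a b ha hb =>
    obtain ⟨k₁, h₁⟩ := ha
    obtain ⟨k₂, h₂⟩ := hb
    refine ⟨max k₁ k₂, fun k hk => ?_⟩
    obtain ⟨p, hp⟩ := h₁ k ((le_max_left _ _).trans hk)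
    obtain ⟨q, hq⟩ := h₂ k ((le_max_right _ _).trans hk)
    exact ⟨p + q, by rw [add_mul, hp, hq, map_add]⟩
  | hmon r i j =>
    refine ⟨j, fun k hk => ⟨monomial (i + (k - j)) r, ?_⟩⟩
    obtain ⟨l, rfl⟩ := Nat.exists_eq_add_of_le hk
    have h : eval₂RingHom' f x hx (monomial (i + (j + l - j)) r) = f r * x ^ (i + (j + l - j)) :=
      eval₂_monomial f x
    rw [h, Nat.add_sub_cancel_left, pow_add x j, mul_assoc, ← mul_assoc (y ^ j),
      pow_mul_pow_of_mul_eq_one hyx, one_mul, mul_assoc, pow_add]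

theorem exists_pow_mul_eq_zero (hyx : y * x = 1) (hx : ∀ r, Commute (f r) x)
    (hy : ∀ r, Commute (f r) y)
    (hgen : ∀ S : Subring A, (∀ r, f r ∈ S) → x ∈ S → y ∈ S → S = ⊤) (k : ℕ) (a : A) :
    ∃ N₀, ∀ N, N₀ ≤ N → y ^ N * (a * (1 - x ^ k * y ^ k)) = 0 := by
  induction a using span_of_oneSidedInverse hyx hx hy hgen with
  | h0 => exact ⟨0, fun N _ => by simp⟩
  | hadd a b ha hb =>
    obtain ⟨k₁, h₁⟩ := ha
    obtain ⟨k₂, h₂⟩ := hb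
    refine ⟨max k₁ k₂, fun N hN => ?_⟩
    rw [add_mul, mul_add, h₁ N ((le_max_left _ _).trans hN), h₂ N ((le_max_right _ _).trans hN),
      add_zero]
  | hmon r i j =>
    refine ⟨k + i, fun N hN => ?_⟩
    obtain ⟨l, rfl⟩ := Nat.exists_eq_add_of_le hN
    have hk : y ^ k * (1 - x ^ k * y ^ k) = 0 := by
      rw [mul_sub, ← mul_assoc, pow_mul_pow_of_mul_eq_one hyx, mul_one, one_mul, sub_self]
    have h : y ^ (k + i + l) * (f r * x ^ i * y ^ j * (1 - x ^ k * y ^ k)) =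
        f r * (y ^ (l + k) * (y ^ i * x ^ i) * y ^ j * (1 - x ^ k * y ^ k)) := by
      calc _ = y ^ (k + i + l) * f r * (x ^ i * y ^ j * (1 - x ^ k * y ^ k)) := by
            simp only [mul_assoc]
        _ = f r * (y ^ (k + i + l) * (x ^ i * y ^ j * (1 - x ^ k * y ^ k))) := by
            rw [← ((hy r).pow_right _).eq, mul_assoc]
        _ = _ := by
            rw [show k + i + l = l + k + i by ring, pow_add y (l + k) i]
            simp only [mul_assoc]
    rw [h, pow_mul_pow_of_mul_eq_one hyx, mul_one, ← pow_add, show l + k + j = l + j + k by ring,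
      pow_add _ _ k, mul_assoc (y ^ (l + j)), hk, mul_zero, mul_zero]

open Polynomial in
/-- The ascending chain condition on two-sided ideals passes from `R` to any ring generated over
the image of `R` by a pair `x`, `y` commuting with that image and satisfying `y * x = 1`. -/
theorem wellFoundedGT_of_oneSidedInverse [WellFoundedGT (TwoSidedIdeal R)]
    (hyx : y * x = 1) (hx : ∀ r, Commute (f r) x) (hy : ∀ r, Commute (f r) y)
    (hgen : ∀ S : Subring A, (∀ r, f r ∈ S) → x ∈ S → y ∈ S → S = ⊤) :
    WellFoundedGT (TwoSidedIdeal A) := by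
  have := wellFoundedGT_twoSidedIdeal_polynomial (R := R)
  have hc : ∀ r, Commute (f r) (1 - x * y) := fun r =>
    (Commute.one_right _).sub_right ((hx r).mul_right (hy r))
  let c : TwoSidedIdeal A → TwoSidedIdeal R := fun I =>
    .mk' {r | f r * (1 - x * y) ∈ I}
      (by simp)
      (fun {r s} hr hs => by
        simpa only [Set.mem_ofPred_eq, map_add, add_mul] using I.add_mem hr hs)
      (fun {r} hr => by simpa only [Set.mem_ofPred_eq, map_neg, neg_mul] using I.neg_mem hr)
      (fun {r s} hs => by
        simpa only [Set.mem_ofPred_eq, map_mul, mul_assoc] using I.mul_mem_left (f r) _ hs)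
      (fun {r s} hr => by
        have h := I.mul_mem_right _ (f s) hr
        rwa [mul_assoc, ← (hc s).eq, ← mul_assoc, ← map_mul] at h)
  have hcmem : ∀ I r, r ∈ c I ↔ f r * (1 - x * y) ∈ I := fun I r => TwoSidedIdeal.mem_mk' ..
  let φ := eval₂RingHom' f x hx
  let L : TwoSidedIdeal A → TwoSidedIdeal R × TwoSidedIdeal R[X] := fun I => (c I, I.comap φ)
  have hL : Monotone L := fun I J h =>
    ⟨fun r hr => (hcmem J r).2 (h ((hcmem I r).1 hr)), TwoSidedIdeal.comap_le_comap φ h⟩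
  refine StrictMono.wellFoundedGT (f := L) fun I J h => ?_
  refine lt_of_le_not_ge (hL h.le) fun h' => h.not_ge fun a ha => ?_
  obtain ⟨k, hk⟩ := exists_mul_pow_eq_eval₂ hyx hx hy hgen a
  obtain ⟨p, hp⟩ := hk k le_rfl
  have h1 : a * x ^ k * y ^ k ∈ I := by
    refine I.mul_mem_right _ _ ?_
    rw [hp]
    refine TwoSidedIdeal.mem_comap φ |>.1 (h'.2 ((TwoSidedIdeal.mem_comap φ).2 ?_))
    change eval₂RingHom' f x hx p ∈ J
    rw [← hp]
    exact J.mul_mem_right _ _ ha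
  obtain ⟨N, hN⟩ := exists_pow_mul_eq_zero hyx hx hy hgen k a
  have hyN := hN N le_rfl
  set d := a * (1 - x ^ k * y ^ k) with hd
  have hdJ : d ∈ J := J.mul_mem_right _ _ ha
  have hdx : d * (1 - x ^ k * y ^ k) = d := by
    rw [hd, mul_assoc]
    congr 1
    rw [mul_sub, mul_one, sub_mul, mul_assoc, ← mul_assoc (y ^ k),
      pow_mul_pow_of_mul_eq_one hyx]
    simp
  have hdd : d = (1 - x ^ N * y ^ N) * d * (1 - x ^ k * y ^ k) := by
    rw [sub_mul, mul_assoc _ (y ^ N), hyN, mul_zero, sub_zero, one_mul, hdx]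
  have hdI : d ∈ I := by
    rw [hdd, one_sub_pow_mul_pow, one_sub_pow_mul_pow, Finset.sum_mul, Finset.sum_mul]
    refine sum_mem fun i _ => ?_
    rw [Finset.mul_sum]
    refine sum_mem fun j _ => ?_
    obtain ⟨r, hr⟩ := exists_corner_eq hyx hx hy hgen (y ^ i * d * x ^ j)
    have hrI : f r * (1 - x * y) ∈ I := by
      refine (hcmem I r).1 (h'.1 ((hcmem J r).2 ?_))
      rw [← hr]
      exact J.mul_mem_right _ _ (J.mul_mem_left _ _
        (J.mul_mem_right _ _ (J.mul_mem_left _ _ hdJ)))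
    have he : x ^ i * (1 - x * y) * y ^ i * d * (x ^ j * (1 - x * y) * y ^ j) =
        x ^ i * (f r * (1 - x * y)) * y ^ j := by
      rw [← hr]; simp only [mul_assoc]
    rw [he]
    exact I.mul_mem_right _ _ (I.mul_mem_left _ _ hrI)
  have hsum : a = a * x ^ k * y ^ k + d := by
    rw [hd, mul_sub, mul_one, mul_assoc]; abel
  rw [hsum]
  exact I.add_mem h1 hdI

end OneSidedInverse

/-- The ascending chain condition on two-sided ideals for an algebra generated by finitely many
commuting pairs `x i`, `y i` with `y i * x i = 1`. -/
theorem wellFoundedGT_twoSidedIdeal_adjoin {K A ι : Type*} [Field K] [Ring A] [Algebra K A]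
    [Nontrivial A] (x y : ι → A) (hyx : ∀ i, y i * x i = 1)
    (hxx : ∀ i j, Commute (x i) (x j)) (hyy : ∀ i j, Commute (y i) (y j))
    (hxy : ∀ i j, i ≠ j → Commute (x i) (y j)) (T : Finset ι) :
    WellFoundedGT (TwoSidedIdeal (Algebra.adjoin K (x '' (T : Set ι) ∪ y '' (T : Set ι)))) := by
  classical
  induction T using Finset.induction_on with
  | empty =>
    have h : Algebra.adjoin K (x '' ((∅ : Finset ι) : Set ι) ∪ y '' ((∅ : Finset ι) : Set ι)) =
        ⊥ := by simp
    rw [h]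
    have : Finite (TwoSidedIdeal K) := open scoped IsSimpleOrder in inferInstance
    exact (Algebra.botEquiv K A).toRingEquiv.mapTwoSidedIdeal.strictMono.wellFoundedGT
  | insert i T hi ih =>
    set B := Algebra.adjoin K (x '' (T : Set ι) ∪ y '' (T : Set ι)) with hB
    set C := Algebra.adjoin K (x '' ((insert i T : Finset ι) : Set ι) ∪
      y '' ((insert i T : Finset ι) : Set ι)) with hC
    have hBC : B ≤ C := Algebra.adjoin_mono (by
      simp only [Finset.coe_insert]
      gcongr <;> exact Set.subset_insert _ _)
    have hxC : x i ∈ C := Algebra.subset_adjoin (Or.inl ⟨i, by simp, rfl⟩)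
    have hyC : y i ∈ C := Algebra.subset_adjoin (Or.inr ⟨i, by simp, rfl⟩)
    have hne : ∀ j ∈ T, j ≠ i := fun j hj h => hi (h ▸ hj)
    have hcx : ∀ b ∈ B, Commute b (x i) := fun b hb => by
      refine Commute.symm (Subalgebra.mem_centralizer_iff K |>.1
        (Algebra.adjoin_le (S := Subalgebra.centralizer K {x i}) ?_ hb) (x i) rfl)
      rintro _ (⟨j, hj, rfl⟩ | ⟨j, hj, rfl⟩)
      · rintro _ rfl; exact hxx i j
      · rintro _ rfl; exact hxy i j (hne j hj).symm
    have hcy : ∀ b ∈ B, Commute b (y i) := fun b hb => by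
      refine Commute.symm (Subalgebra.mem_centralizer_iff K |>.1
        (Algebra.adjoin_le (S := Subalgebra.centralizer K {y i}) ?_ hb) (y i) rfl)
      rintro _ (⟨j, hj, rfl⟩ | ⟨j, hj, rfl⟩)
      · rintro _ rfl; exact (hxy j i (hne j hj)).symm
      · rintro _ rfl; exact hyy i j
    refine wellFoundedGT_of_oneSidedInverse (f := (Subalgebra.inclusion hBC).toRingHom)
      (x := ⟨x i, hxC⟩) (y := ⟨y i, hyC⟩) (Subtype.ext (hyx i))
      (fun b => Subtype.ext (hcx b b.2)) (fun b => Subtype.ext (hcy b b.2)) ?_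
    intro S hf hx hy
    let S' : Subalgebra K C :=
      { S with algebraMap_mem' := fun r => hf (algebraMap K B r) }
    have hle : C ≤ S'.map C.val := by
      refine Algebra.adjoin_le ?_
      rintro _ (⟨j, hj, rfl⟩ | ⟨j, hj, rfl⟩)
      · rcases Finset.mem_insert.1 hj with rfl | hj
        · exact ⟨_, hx, rfl⟩
        · exact ⟨_, hf ⟨x j, Algebra.subset_adjoin (Or.inl ⟨j, hj, rfl⟩)⟩, rfl⟩
      · rcases Finset.mem_insert.1 hj with rfl | hj
        · exact ⟨_, hy, rfl⟩
        · exact ⟨_, hf ⟨y j, Algebra.subset_adjoin (Or.inr ⟨j, hj, rfl⟩)⟩, rfl⟩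
    refine eq_top_iff.2 fun c _ => ?_
    obtain ⟨c', hc', h⟩ := hle c.2
    rwa [← Subtype.ext h]

section Operators

variable {K : Type*} [Field K] {n : ℕ}

theorem Xop_monomial (i : Fin n) (α : Fin n →₀ ℕ) :
    Xop K n i (monomial α 1) = monomial (α + Finsupp.single i 1) 1 := by
  rw [Xop, LinearMap.mulLeft_apply, X, monomial_mul, one_mul, add_comm]

theorem Yop_monomial (i : Fin n) (α : Fin n →₀ ℕ) :
    Yop K n i (monomial α 1) = if α i = 0 then 0 else monomial (α - Finsupp.single i 1) 1 := by
  have h := (basisMonomials (Fin n) K).constr_basis K (fun α : Fin n →₀ ℕ =>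
    if α i = 0 then (0 : PolyAlg K n) else monomial (α - Finsupp.single i 1) (1 : K)) α
  rwa [coe_basisMonomials] at h

theorem end_ext_monomial {g h : Module.End K (PolyAlg K n)}
    (H : ∀ α, g (monomial α 1) = h (monomial α 1)) : g = h :=
  (basisMonomials (Fin n) K).ext fun α => by simpa using H α

theorem Yop_mul_Xop (i : Fin n) : Yop K n i * Xop K n i = 1 :=
  end_ext_monomial fun α => by
    simp [Module.End.mul_apply, Xop_monomial, Yop_monomial]

theorem commute_Xop (i j : Fin n) : Commute (Xop K n i) (Xop K n j) :=
  end_ext_monomial fun α => by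
    simp only [Module.End.mul_apply, Xop_monomial]
    rw [add_right_comm]

theorem commute_Xop_Yop {i j : Fin n} (hij : i ≠ j) : Commute (Xop K n i) (Yop K n j) :=
  end_ext_monomial fun α => by
    simp only [Module.End.mul_apply, Xop_monomial, Yop_monomial, apply_ite (Xop K n i), map_zero,
      Finsupp.add_apply, Finsupp.single_eq_of_ne hij.symm, add_zero]
    split_ifs with h
    · rfl
    · rw [tsub_add_eq_add_tsub]
      exact Finsupp.single_le_iff.2 (Nat.one_le_iff_ne_zero.2 h)

theorem commute_Yop (i j : Fin n) : Commute (Yop K n i) (Yop K n j) := by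
  rcases eq_or_ne i j with rfl | hij
  · exact Commute.refl _
  refine end_ext_monomial fun α => ?_
  simp only [Module.End.mul_apply, Yop_monomial, apply_ite (Yop K n i), apply_ite (Yop K n j),
    map_zero, Finsupp.tsub_apply, Finsupp.single_eq_of_ne hij, Finsupp.single_eq_of_ne hij.symm,
    tsub_zero]
  rw [tsub_right_comm]
  split_ifs <;> rfl

end Operators

theorem wellFoundedGT_twoSidedIdeal_SnAlg (K : Type*) [Field K] (n : ℕ) :
    WellFoundedGT (TwoSidedIdeal (SnAlg K n)) := by
  have h := wellFoundedGT_twoSidedIdeal_adjoin (K := K) (Xop K n) (Yop K n) Yop_mul_Xop commute_Xop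
    commute_Yop (fun _ _ => commute_Xop_Yop) Finset.univ
  rwa [Finset.coe_univ, Set.image_univ, Set.image_univ] at h

/-- for each proper two-sided ideal `a` of `S_n`, the set `Min(a)` of minimal
primes over `a` is finite and non-empty. -/
theorem statement7 (K : Type u) [Field K] (n : ℕ) (hn : 0 < n)
    (a : TwoSidedIdeal (SnAlg K n)) (ha : a ≠ ⊤) :
    (minPrimesOver a).Finite ∧ (minPrimesOver a).Nonempty := by
  have := wellFoundedGT_twoSidedIdeal_SnAlg K n
  exact minPrimesOver_finite_nonempty ha
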